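/- For every integer n ≥ 1, every word u of length n−1 over {a,b}, and all integers j ≥ 0 and r ≥ 1, the number of Catalan tableaux of index n with profile u, exactly j ones in the first row, and exactly r unrestricted rows equals the number of binary trees with n vertices with canopy u whose left branch has length j+1 and whose right branch has length r. -/

import Mathlib

/-- A binary tree: empty, or a root with a left and a right subtree. -/
inductive BinTree : Type
  | nil : BinTree
  | node : BinTree → BinTree → BinTree
  deriving DecidableEq

/-- Number of vertices of a binary tree. -/
def BinTree.size : BinTree → ℕ
  | .nil => 0
  | .node l r => l.size + r.size + 1

/-- Length (number of vertices) of the left branch. -/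
def BinTree.leftBranchLen : BinTree → ℕ
  | .nil => 0
  | .node l _ => l.leftBranchLen + 1

/-- Length (number of vertices) of the right branch. -/
def BinTree.rightBranchLen : BinTree → ℕ
  | .nil => 0
  | .node _ r => r.rightBranchLen + 1

/-- Word over {a,b} (a = `true`, b = `false`) reading the vertices in symmetric
(in-)order; a vertex contributes `true` iff it has a right child. -/
def BinTree.canopyFull : BinTree → List Bool
  | .nil => []
  | .node l r => l.canopyFull ++ (decide (r ≠ BinTree.nil)) :: r.canopyFull

/-- The canopy of a binary tree with `n` vertices: the word `u₁ … u_{n-1}` over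
{a = `true`, b = `false`} with `uᵢ = a` iff the `i`-th vertex in symmetric order
has a right child.  (The last vertex in symmetric order never has a right child,
so it is dropped.) -/
def BinTree.canopy (B : BinTree) : List Bool := B.canopyFull.dropLast

/-- A Catalan tableau of index `n`: a partition `λ₁ ≥ … ≥ λ_k` with `λ₁ = n - k`,
drawn right-justified inside the `k × (n-k)` rectangle (rows bottom to top, row `i`
having `lam i` cells, occupying columns `j` with `m - lam i ≤ j < m` where
`m = n - k`), filled with 0's (`false`) and 1's (`true`) such that every column
contains exactly one 1 and no 0 has both a 1 below it in its column and a 1 to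
its right in its row.  Entries outside the diagram are forced to `false`. -/
structure CatalanTableau (n : ℕ) where
  k : ℕ
  m : ℕ
  hk : 0 < k
  hkm : k + m = n
  lam : Fin k → ℕ
  lam_le : ∀ i, lam i ≤ m
  lam_first : lam ⟨0, hk⟩ = m
  lam_anti : ∀ i j : Fin k, i ≤ j → lam j ≤ lam i
  f : Fin k → Fin m → Bool
  f_outside : ∀ (i : Fin k) (j : Fin m), (j : ℕ) < m - lam i → f i j = false
  col_one : ∀ j : Fin m, ∃! i : Fin k, f i j = true
  no_bad : ∀ (i : Fin k) (j : Fin m), m - lam i ≤ (j : ℕ) → f i j = false →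
    ¬ ((∃ i' : Fin k, i' < i ∧ f i' j = true) ∧
       (∃ j' : Fin m, (j : ℕ) < (j' : ℕ) ∧ f i j' = true))

/-- The profile of a Catalan tableau: the NW border of its Ferrers diagram read
from the bottom-left corner of the rectangle to its top-right corner
(a = `true` for a north step, b = `false` for an east step), with the first
letter (always a north step) deleted. -/
def CatalanTableau.profile {n : ℕ} (T : CatalanTableau n) : List Bool :=
  ((List.finRange T.k).flatMap (fun i =>
    true :: List.replicate
      (T.lam i - (if h : (i : ℕ) + 1 < T.k then T.lam ⟨(i : ℕ) + 1, h⟩ else 0)) false)).tail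

/-- Number of 1's in the first (bottom) row of a Catalan tableau. -/
noncomputable def CatalanTableau.onesFirstRow {n : ℕ} (T : CatalanTableau n) : ℕ :=
  Nat.card {j : Fin T.m // T.f ⟨0, T.hk⟩ j = true}

/-- An entry is restricted if it is a 0 (in a cell of the diagram) lying above
some 1 in its column. -/
def CatalanTableau.Restricted {n : ℕ} (T : CatalanTableau n)
    (i : Fin T.k) (j : Fin T.m) : Prop :=
  T.m - T.lam i ≤ (j : ℕ) ∧ T.f i j = false ∧ ∃ i' : Fin T.k, i' < i ∧ T.f i' j = true

/-- Number of unrestricted rows (rows of the rectangle containing no restricted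
entry). -/
noncomputable def CatalanTableau.unrestrictedRows {n : ℕ} (T : CatalanTableau n) : ℕ :=
  Nat.card {i : Fin T.k // ∀ j : Fin T.m, ¬ T.Restricted i j}

/-- `weaklyBelow ω η`: the lattice paths coded by `ω`, `η` (a = `true` = north
step, b = `false` = east step, both starting at the origin) have the same
endpoints and `η` never passes strictly above `ω`. -/
def weaklyBelow (ω η : List Bool) : Prop :=
  η.length = ω.length ∧ η.count true = ω.count true ∧
    ∀ t : ℕ, (η.take t).count true ≤ (ω.take t).count true

/-- Heights at which the successive east steps of a path occur. -/
def eastHeightsAux : ℕ → List Bool → List ℕ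
  | _, [] => []
  | h, true :: w => eastHeightsAux (h + 1) w
  | h, false :: w => h :: eastHeightsAux h w

def eastHeights (w : List Bool) : List ℕ := eastHeightsAux 0 w

/-- Number of horizontal contacts of two paths: unit east edges traversed by
both paths. -/
def contacts (ω η : List Bool) : ℕ :=
  ((eastHeights ω).zip (eastHeights η)).countP (fun p => p.1 == p.2)

/-- Number of trailing north steps of a path. -/
def trailingNorth (w : List Bool) : ℕ := (w.reverse.takeWhile (· == true)).length

/-- Number of left edges, i.e. of vertices having a left child. -/
def BinTree.leftEdgeCount : BinTree → ℕ
  | .nil => 0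
  | .node l r => l.leftEdgeCount + r.leftEdgeCount + (if l = BinTree.nil then 0 else 1)

/-- Number of vertices having no right child. -/
def BinTree.noRightCount : BinTree → ℕ
  | .nil => 0
  | .node l r => l.noRightCount + r.noRightCount + (if r = BinTree.nil then 1 else 0)

/-- Symmetric-order traversal recording, for each vertex, whether it has a left
child, whether it has a right child, and its right height (the second argument
is the right height of the current root). -/
def BinTree.inorderAux : BinTree → ℕ → List (Bool × Bool × ℕ)
  | .nil, _ => []
  | .node l r, h =>
      BinTree.inorderAux l h ++
        (decide (l ≠ BinTree.nil), decide (r ≠ BinTree.nil), h) :: BinTree.inorderAux r (h + 1)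

def BinTree.inorder (B : BinTree) : List (Bool × Bool × ℕ) := B.inorderAux 0

/-- The sequence `ρ₁, …, ρ_m`: right heights of the parents of the left edges,
the left edges being ordered by their parents in symmetric order. -/
def BinTree.rhoList (B : BinTree) : List ℕ :=
  (B.inorder.filter (fun v => v.1)).map (fun v => v.2.2)

def hsAux : List (Bool × Bool × ℕ) → ℕ → List ℕ
  | [], _ => []
  | v :: rest, c => if v.2.1 then hsAux rest (c + 1) else c :: hsAux rest c

/-- The sequence `h₁, …, h_m`: for each vertex with no right child (in symmetric
order, excluding the last vertex in symmetric order), the number of vertices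
preceding it in symmetric order that have a right child. -/
def BinTree.hList (B : BinTree) : List ℕ := (hsAux B.inorder 0).dropLast

/-- Leaves of the completion `γ(B)` in symmetric order, each recorded as `true`
if it is a left child of its parent and `false` if it is a right child; the
boolean argument records whether the current subtree sits as a left child. -/
def BinTree.gammaLeavesAux : BinTree → Bool → List Bool
  | .nil, isLeft => [isLeft]
  | .node l r, _ => BinTree.gammaLeavesAux l true ++ BinTree.gammaLeavesAux r false

/-- The word of the leaves of the complete binary tree `γ(B)` in symmetric order
(a = `true` for a left child, b = `false` for a right child). -/
def BinTree.leafWord : BinTree → List Bool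
  | .nil => []
  | .node l r => BinTree.gammaLeavesAux l true ++ BinTree.gammaLeavesAux r false

namespace BinTree

/-- Insert a new vertex at depth `t` on the right branch; the part of the tree that was there
becomes the left subtree of the new vertex. -/
def insertRight : ℕ → BinTree → BinTree
  | 0, B => .node B .nil
  | _ + 1, .nil => .node .nil .nil
  | t + 1, .node l r => .node l (insertRight t r)

/-- Remove the last vertex in symmetric order, replacing it by its left subtree. -/
def eraseLast : BinTree → BinTree
  | .nil => .nil
  | .node l r => if r = .nil then l else .node l (eraseLast r)

theorem insertRight_ne_nil (t : ℕ) (B : BinTree) : insertRight t B ≠ .nil := by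
  cases t <;> cases B <;> simp [insertRight]

theorem size_insertRight (t : ℕ) (B : BinTree) : (insertRight t B).size = B.size + 1 := by
  induction t generalizing B with
  | zero => simp [insertRight, size]
  | succ t ih => cases B <;> simp [insertRight, size, ih]; omega

theorem rightBranchLen_insertRight {t : ℕ} {B : BinTree} (h : t ≤ B.rightBranchLen) :
    (insertRight t B).rightBranchLen = t + 1 := by
  induction t generalizing B with
  | zero => simp [insertRight, rightBranchLen]
  | succ t ih =>
    cases B with
    | nil => simp [rightBranchLen] at h
    | node l r => simpa [insertRight, rightBranchLen] using ih (by simpa [rightBranchLen] using h)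

theorem leftBranchLen_insertRight_zero (B : BinTree) :
    (insertRight 0 B).leftBranchLen = B.leftBranchLen + 1 := rfl

theorem leftBranchLen_insertRight_of_pos {t : ℕ} {B : BinTree} (ht : 0 < t) (hB : B ≠ .nil) :
    (insertRight t B).leftBranchLen = B.leftBranchLen := by
  obtain ⟨t, rfl⟩ := Nat.exists_eq_succ_of_ne_zero ht.ne'
  cases B with
  | nil => exact absurd rfl hB
  | node l r => rfl

theorem canopyFull_insertRight_of_lt {t : ℕ} {B : BinTree} (h : t < B.rightBranchLen) :
    (insertRight t B).canopyFull = B.canopyFull ++ [false] := by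
  induction t generalizing B with
  | zero => simp [insertRight, canopyFull]
  | succ t ih =>
    cases B with
    | nil => simp [rightBranchLen] at h
    | node l r =>
      have hr : t < r.rightBranchLen := by simpa [rightBranchLen] using h
      have : r ≠ .nil := by rintro rfl; simp [rightBranchLen] at hr
      simp [insertRight, canopyFull, ih hr, insertRight_ne_nil, this]

theorem exists_canopyFull_eq {B : BinTree} (hB : B ≠ .nil) :
    ∃ w, B.canopyFull = w ++ [false] ∧
      (insertRight B.rightBranchLen B).canopyFull = w ++ [true, false] := by
  induction B with
  | nil => exact absurd rfl hB
  | node l r _ ih =>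
    by_cases hr : r = .nil
    · subst hr
      exact ⟨l.canopyFull, by simp [canopyFull, rightBranchLen, insertRight]⟩
    · obtain ⟨w, h₁, h₂⟩ := ih hr
      exact ⟨l.canopyFull ++ true :: w, by
        simp [canopyFull, rightBranchLen, insertRight, h₁, h₂, hr, insertRight_ne_nil]⟩

theorem canopy_insertRight_of_lt {t : ℕ} {B : BinTree} (h : t < B.rightBranchLen) :
    (insertRight t B).canopy = B.canopy ++ [false] := by
  have hB : B ≠ .nil := by rintro rfl; simp [rightBranchLen] at h
  obtain ⟨w, hw, -⟩ := exists_canopyFull_eq hB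
  simp [canopy, canopyFull_insertRight_of_lt h, hw]

theorem canopy_insertRight_rightBranchLen {B : BinTree} (hB : B ≠ .nil) :
    (insertRight B.rightBranchLen B).canopy = B.canopy ++ [true] := by
  obtain ⟨w, hw, hw'⟩ := exists_canopyFull_eq hB
  rw [canopy, canopy, hw, hw', show w ++ [true, false] = (w ++ [true]) ++ [false] by simp,
    List.dropLast_concat, List.dropLast_concat]

theorem eraseLast_insertRight {t : ℕ} {B : BinTree} (h : t ≤ B.rightBranchLen) :
    (insertRight t B).eraseLast = B := by
  induction t generalizing B with
  | zero => simp [insertRight, eraseLast]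
  | succ t ih =>
    cases B with
    | nil => simp [rightBranchLen] at h
    | node l r =>
      simp [insertRight, eraseLast, insertRight_ne_nil,
        ih (show t ≤ r.rightBranchLen by simpa [rightBranchLen] using h)]

theorem exists_insertRight_eraseLast {B : BinTree} (hB : B ≠ .nil) :
    ∃ t ≤ B.eraseLast.rightBranchLen, insertRight t B.eraseLast = B := by
  induction B with
  | nil => exact absurd rfl hB
  | node l r _ ih =>
    by_cases hr : r = .nil
    · exact ⟨0, by simp [eraseLast, hr, insertRight]⟩
    · obtain ⟨t, ht, h⟩ := ih hr
      exact ⟨t + 1, by simp [eraseLast, hr, rightBranchLen, ht],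
        by simp [eraseLast, hr, insertRight, h]⟩

end BinTree

/-- Validity of the data `(k, P)` of a tableau with `k` rows, where `P` lists the columns from
right to left as pairs (row of the 1, height). -/
structure ValidCode (k : ℕ) (P : List (ℕ × ℕ)) : Prop where
  pos : 0 < k
  bound : ∀ p ∈ P, p.1 < p.2 ∧ p.2 ≤ k
  pairwise : P.Pairwise fun a b => b.2 ≤ a.2 ∧ ¬ (b.1 < a.1 ∧ a.1 < b.2)

/-- The unrestricted rows. -/
def freeRows (k : ℕ) (P : List (ℕ × ℕ)) : Finset ℕ :=
  (Finset.range k).filter fun i => ∀ p ∈ P, ¬ (p.1 < i ∧ i < p.2)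

/-- The profile read off the data `(k, P)`. -/
def codeProfile (k : ℕ) (P : List (ℕ × ℕ)) : List Bool :=
  ((List.range k).flatMap fun i =>
    true :: List.replicate (P.countP fun p => p.2 = i + 1) false).tail

/-- The binary tree built from the data `(k, P)`. -/
def codeTree : ℕ → List (ℕ × ℕ) → BinTree
  | k, [] => (fun B => BinTree.insertRight B.rightBranchLen B)^[k] .nil
  | k, p :: P => (fun B => BinTree.insertRight B.rightBranchLen B)^[k - p.2]
      (BinTree.insertRight ((freeRows p.2 (p :: P)).card - 1) (codeTree p.2 P))

section Code

variable {k c : ℕ} {P : List (ℕ × ℕ)}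

theorem mem_freeRows {i : ℕ} :
    i ∈ freeRows k P ↔ i < k ∧ ∀ p ∈ P, ¬ (p.1 < i ∧ i < p.2) := by
  simp [freeRows]

theorem zero_mem_freeRows (hk : 0 < k) : 0 ∈ freeRows k P := by
  simp [mem_freeRows, hk]

theorem freeRows_succ (h : ValidCode k P) : freeRows (k + 1) P = insert k (freeRows k P) := by
  ext i
  simp only [Finset.mem_insert, mem_freeRows]
  constructor
  · rintro ⟨hi, hP⟩
    by_cases hik : i = k
    · exact .inl hik
    · exact .inr ⟨by omega, hP⟩
  · rintro (rfl | ⟨hi, hP⟩)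
    · exact ⟨by omega, fun p hp => by have := h.bound p hp; omega⟩
    · exact ⟨by omega, hP⟩

theorem card_freeRows_succ (h : ValidCode k P) :
    (freeRows (k + 1) P).card = (freeRows k P).card + 1 := by
  rw [freeRows_succ h, Finset.card_insert_of_notMem (by simp [mem_freeRows])]

theorem freeRows_cons : freeRows k ((c, k) :: P) = (freeRows k P).filter (· ≤ c) := by
  ext i
  simp only [Finset.mem_filter, mem_freeRows, List.forall_mem_cons]
  constructor
  · rintro ⟨h₁, h₂, h₃⟩
    exact ⟨⟨h₁, h₃⟩, by omega⟩
  · rintro ⟨⟨h₁, h₃⟩, h₂⟩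
    exact ⟨h₁, by omega, h₃⟩

theorem card_freeRows_cons_pos (hk : 0 < k) : 0 < (freeRows k ((c, k) :: P)).card :=
  Finset.card_pos.2 ⟨0, zero_mem_freeRows hk⟩

theorem card_freeRows_cons_le : (freeRows k ((c, k) :: P)).card ≤ (freeRows k P).card := by
  rw [freeRows_cons]
  exact Finset.card_filter_le _ _

theorem Finset.card_filter_le_injOn (F : Finset ℕ) :
    Set.InjOn (fun c => (F.filter (· ≤ c)).card) F := by
  refine StrictMonoOn.injOn fun a _ b hb hab => Finset.card_lt_card ?_
  rw [Finset.ssubset_iff_of_subset]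
  · exact ⟨b, by simpa using hb, by simp [hab]⟩
  · intro x
    simp only [Finset.mem_filter]
    exact fun hx => ⟨hx.1, hx.2.trans hab.le⟩

theorem Finset.exists_card_filter_le_eq (F : Finset ℕ) {t : ℕ} (ht : t < F.card) :
    ∃ c ∈ F, (F.filter (· ≤ c)).card = t + 1 := by
  have hsurj := Finset.surj_on_of_inj_on_of_card_le (s := F) (t := Finset.Icc 1 F.card)
    (fun c _ => (F.filter (· ≤ c)).card)
    (fun c hc => Finset.mem_Icc.2
      ⟨Finset.card_pos.2 ⟨c, by simp [hc]⟩, Finset.card_filter_le _ _⟩)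
    (fun a b ha hb => F.card_filter_le_injOn ha hb) (by simp)
  obtain ⟨c, hc, h⟩ := hsurj (t + 1) (Finset.mem_Icc.2 (by omega))
  exact ⟨c, hc, h.symm⟩

theorem ValidCode.succ (h : ValidCode k P) : ValidCode (k + 1) P :=
  ⟨k.succ_pos, fun p hp => ⟨(h.bound p hp).1, by have := h.bound p hp; omega⟩, h.pairwise⟩

theorem ValidCode.cons (h : ValidCode k P) (hc : c ∈ freeRows k P) :
    ValidCode k ((c, k) :: P) := by
  rw [mem_freeRows] at hc
  exact ⟨h.pos, List.forall_mem_cons.2 ⟨⟨hc.1, le_rfl⟩, h.bound⟩,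
    List.pairwise_cons.2 ⟨fun p hp => ⟨(h.bound p hp).2, hc.2 p hp⟩, h.pairwise⟩⟩

theorem ValidCode.one_nil : ValidCode 1 [] := ⟨one_pos, by simp, by simp⟩

/-- Every valid code arises from `(1, [])` by adding empty rows on top and full-height columns
on the right. -/
theorem ValidCode.induction_on_steps {motive : ∀ k P, ValidCode k P → Prop}
    (one : motive 1 [] .one_nil)
    (succ : ∀ k P (h : ValidCode k P), motive k P h → motive (k + 1) P h.succ)
    (cons : ∀ k c P (h : ValidCode k P) (hc : c ∈ freeRows k P), motive k P h →
      motive k ((c, k) :: P) (h.cons hc))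
    (h : ValidCode k P) : motive k P h := by
  induction P generalizing k with
  | nil =>
    have hv : ∀ k, 0 < k → ValidCode k [] := fun k hk => ⟨hk, by simp, by simp⟩
    exact Nat.le_induction (P := fun k hk => motive k [] (hv k hk)) one
      (fun k hk => succ k [] (hv k hk)) k h.pos
  | cons p P ih =>
    obtain ⟨c, l⟩ := p
    have hb := List.forall_mem_cons.1 h.bound
    have hp := List.pairwise_cons.1 h.pairwise
    have hl : ValidCode l P := ⟨by have := hb.1; omega,
      fun p hp' => ⟨(hb.2 p hp').1, (hp.1 p hp').1⟩, hp.2⟩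
    have hc : c ∈ freeRows l P := mem_freeRows.2 ⟨hb.1.1, fun p hp' => (hp.1 p hp').2⟩
    suffices ∀ k, l ≤ k → ∃ hk : ValidCode k ((c, l) :: P), motive k ((c, l) :: P) hk from
      (this k hb.1.2).2
    exact Nat.le_induction ⟨hl.cons hc, cons l c P hl hc (ih hl)⟩
      fun k _ ⟨hk, hm⟩ => ⟨hk.succ, succ k _ hk hm⟩

theorem codeTree_succ (h : ValidCode k P) :
    codeTree (k + 1) P =
      BinTree.insertRight (codeTree k P).rightBranchLen (codeTree k P) := by
  cases P with
  | nil => simp only [codeTree, Function.iterate_succ_apply']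
  | cons p P =>
    have := (h.bound p (by simp)).2
    simp only [codeTree, Nat.succ_sub this, Function.iterate_succ_apply']

theorem codeTree_cons : codeTree k ((c, k) :: P) =
    BinTree.insertRight ((freeRows k ((c, k) :: P)).card - 1) (codeTree k P) := by
  simp [codeTree]

theorem codeTree_ne_nil (h : ValidCode k P) : codeTree k P ≠ .nil := by
  induction h using ValidCode.induction_on_steps with
  | one => simp [codeTree, BinTree.insertRight_ne_nil]
  | succ k P h _ => simp [codeTree_succ h, BinTree.insertRight_ne_nil]
  | cons k c P => simp [codeTree_cons, BinTree.insertRight_ne_nil]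

theorem size_codeTree (h : ValidCode k P) : (codeTree k P).size = k + P.length := by
  induction h using ValidCode.induction_on_steps with
  | one => rfl
  | succ k P h ih => rw [codeTree_succ h, BinTree.size_insertRight, ih]; omega
  | cons k c P h hc ih =>
    rw [codeTree_cons, BinTree.size_insertRight, ih, List.length_cons]; omega

theorem rightBranchLen_codeTree (h : ValidCode k P) :
    (codeTree k P).rightBranchLen = (freeRows k P).card := by
  induction h using ValidCode.induction_on_steps with
  | one => rfl
  | succ k P h ih =>
    rw [codeTree_succ h, BinTree.rightBranchLen_insertRight le_rfl, card_freeRows_succ h, ih]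
  | cons k c P h hc ih =>
    have h₁ := card_freeRows_cons_pos (c := c) (P := P) h.pos
    have h₂ := card_freeRows_cons_le (k := k) (c := c) (P := P)
    rw [codeTree_cons, BinTree.rightBranchLen_insertRight (by omega)]
    omega

theorem leftBranchLen_codeTree (h : ValidCode k P) :
    (codeTree k P).leftBranchLen = P.countP (fun p => p.1 = 0) + 1 := by
  induction h using ValidCode.induction_on_steps with
  | one => rfl
  | succ k P h ih =>
    have hpos : 0 < (codeTree k P).rightBranchLen := by
      rw [rightBranchLen_codeTree h]
      exact Finset.card_pos.2 ⟨0, zero_mem_freeRows h.pos⟩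
    rw [codeTree_succ h,
      BinTree.leftBranchLen_insertRight_of_pos hpos (codeTree_ne_nil h), ih]
  | cons k c P h hc ih =>
    rw [codeTree_cons]
    by_cases h0 : c = 0
    · subst h0
      have : freeRows k ((0, k) :: P) = {0} := by
        rw [freeRows_cons]
        ext i
        simp only [Finset.mem_filter, Nat.le_zero, Finset.mem_singleton]
        exact ⟨fun hi => hi.2, fun hi => ⟨hi ▸ hc, hi⟩⟩
      simp [this, BinTree.leftBranchLen_insertRight_zero, ih]
    · have : 1 < (freeRows k ((c, k) :: P)).card := by
        rw [freeRows_cons, Finset.one_lt_card]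
        exact ⟨0, by simp [zero_mem_freeRows h.pos], c, by simp [hc], Ne.symm h0⟩
      rw [BinTree.leftBranchLen_insertRight_of_pos (by omega) (codeTree_ne_nil h), ih]
      simp [h0]

theorem canopy_codeTree_succ (h : ValidCode k P) :
    (codeTree (k + 1) P).canopy = (codeTree k P).canopy ++ [true] := by
  rw [codeTree_succ h, BinTree.canopy_insertRight_rightBranchLen (codeTree_ne_nil h)]

theorem canopy_codeTree_cons (h : ValidCode k P) :
    (codeTree k ((c, k) :: P)).canopy = (codeTree k P).canopy ++ [false] := by
  have h₁ := card_freeRows_cons_pos (c := c) (P := P) h.pos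
  have h₂ := card_freeRows_cons_le (k := k) (c := c) (P := P)
  rw [codeTree_cons, BinTree.canopy_insertRight_of_lt (by rw [rightBranchLen_codeTree h]; omega)]

theorem codeProfile_succ (h : ValidCode k P) :
    codeProfile (k + 1) P = codeProfile k P ++ [true] := by
  have hz : P.countP (fun p => decide (p.2 = k + 1)) = 0 := by
    rw [List.countP_eq_zero]
    intro p hp
    have := h.bound p hp
    simpa using (show p.2 ≠ k + 1 by omega)
  obtain ⟨k, rfl⟩ := Nat.exists_eq_succ_of_ne_zero h.pos.ne'
  rw [codeProfile, codeProfile, List.range_succ, List.flatMap_append, List.tail_append_of_ne_nil]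
  · simp [hz]
  · simp [List.range_succ]

theorem codeProfile_cons (hk : 0 < k) :
    codeProfile k ((c, k) :: P) = codeProfile k P ++ [false] := by
  obtain ⟨k, rfl⟩ := Nat.exists_eq_succ_of_ne_zero hk.ne'
  rw [codeProfile, codeProfile, ← List.tail_append_of_ne_nil (by simp [List.range_succ])]
  congr 1
  rw [List.range_succ, List.flatMap_append, List.flatMap_append, List.append_assoc]
  congr 1
  · refine List.flatMap_congr fun i hi => ?_
    have : k ≠ i := by rw [List.mem_range] at hi; omega
    simp [this]
  · simp [List.replicate_succ']

theorem canopy_codeTree (h : ValidCode k P) : (codeTree k P).canopy = codeProfile k P := by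
  induction h using ValidCode.induction_on_steps with
  | one => rfl
  | succ k P h ih => rw [canopy_codeTree_succ h, codeProfile_succ h, ih]
  | cons k c P h hc ih => rw [canopy_codeTree_cons h, codeProfile_cons h.pos, ih]

theorem eraseLast_codeTree_succ (h : ValidCode k P) :
    (codeTree (k + 1) P).eraseLast = codeTree k P := by
  rw [codeTree_succ h, BinTree.eraseLast_insertRight le_rfl]

theorem eraseLast_codeTree_cons (h : ValidCode k P) :
    (codeTree k ((c, k) :: P)).eraseLast = codeTree k P := by
  have h₂ := card_freeRows_cons_le (k := k) (c := c) (P := P)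
  rw [codeTree_cons, BinTree.eraseLast_insertRight (by rw [rightBranchLen_codeTree h]; omega)]

theorem codeTree_injective (h : ValidCode k P) {k' : ℕ} {P' : List (ℕ × ℕ)}
    (h' : ValidCode k' P') (heq : codeTree k P = codeTree k' P') : k = k' ∧ P = P' := by
  induction h using ValidCode.induction_on_steps generalizing k' P' with
  | one =>
    have hs := congrArg BinTree.size heq
    have hpos := h'.pos
    rw [size_codeTree h', codeTree] at hs
    have hs : 1 = k' + P'.length := hs
    exact ⟨by omega, (List.eq_nil_of_length_eq_zero (by omega)).symm⟩
  | succ k P h ih =>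
    cases h' using ValidCode.induction_on_steps with
    | one =>
      have hs := congrArg BinTree.size heq
      have hpos := h.pos
      rw [size_codeTree h.succ] at hs
      have hs : k + 1 + P.length = 1 := hs
      omega
    | succ k' P' h' _ =>
      have := congrArg BinTree.eraseLast heq
      rw [eraseLast_codeTree_succ h, eraseLast_codeTree_succ h'] at this
      obtain ⟨rfl, rfl⟩ := ih h' this
      exact ⟨rfl, rfl⟩
    | cons k' c' P' h' hc' _ =>
      have := congrArg (fun B => B.canopy.getLast?) heq
      simp [canopy_codeTree_succ h, canopy_codeTree_cons h'] at this
  | cons k c P h hc ih =>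
    cases h' using ValidCode.induction_on_steps with
    | one =>
      have hs := congrArg BinTree.size heq
      have hpos := h.pos
      rw [size_codeTree (h.cons hc), List.length_cons] at hs
      have hs : k + (P.length + 1) = 1 := hs
      omega
    | succ k' P' h' _ =>
      have := congrArg (fun B => B.canopy.getLast?) heq
      simp [canopy_codeTree_succ h', canopy_codeTree_cons h] at this
    | cons k' c' P' h' hc' _ =>
      have := congrArg BinTree.eraseLast heq
      rw [eraseLast_codeTree_cons h, eraseLast_codeTree_cons h'] at this
      obtain ⟨rfl, rfl⟩ := ih h' this
      have := congrArg BinTree.rightBranchLen heq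
      rw [rightBranchLen_codeTree (h.cons hc), rightBranchLen_codeTree (h.cons hc'),
        freeRows_cons, freeRows_cons] at this
      rw [Finset.card_filter_le_injOn _ hc hc' this]
      exact ⟨rfl, rfl⟩

theorem exists_codeTree_eq {B : BinTree} (hB : B ≠ .nil) :
    ∃ k P, ValidCode k P ∧ codeTree k P = B := by
  obtain ⟨t, ht, h⟩ := BinTree.exists_insertRight_eraseLast hB
  by_cases hE : B.eraseLast = .nil
  · refine ⟨1, [], .one_nil, ?_⟩
    rw [hE] at h ht
    obtain rfl : t = 0 := Nat.le_zero.1 ht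
    exact h
  · obtain ⟨k, P, hv, hT⟩ := exists_codeTree_eq hE
    rw [← hT] at h ht
    rcases ht.lt_or_eq with ht | rfl
    · rw [rightBranchLen_codeTree hv] at ht
      obtain ⟨c, hc, hcard⟩ := Finset.exists_card_filter_le_eq _ ht
      refine ⟨k, (c, k) :: P, hv.cons hc, ?_⟩
      rw [codeTree_cons, freeRows_cons, hcard, Nat.add_sub_cancel, h]
    · exact ⟨k + 1, P, hv.succ, by rw [codeTree_succ hv, h]⟩
termination_by B.size
decreasing_by
  have := congrArg BinTree.size h
  rw [BinTree.size_insertRight] at this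
  omega

end Code

theorem Fin.sub_card_filter_le_iff {m : ℕ} (S : Fin m → Prop) [DecidablePred S]
    (hS : Monotone S) (j : Fin m) :
    m - (Finset.univ.filter S).card ≤ (j : ℕ) ↔ S j := by
  have hj := j.isLt
  constructor
  · contrapose
    intro hSj
    have : Finset.univ.filter S ⊆ Finset.Ioi j := fun x hx => by
      rw [Finset.mem_Ioi]
      by_contra hxj
      exact hSj (hS (not_lt.1 hxj) (Finset.mem_filter.1 hx).2)
    have := Finset.card_le_card this
    rw [Fin.card_Ioi] at this
    omega
  · intro hSj
    have : Finset.Ici j ⊆ Finset.univ.filter S := fun x hx =>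
      Finset.mem_filter.2 ⟨Finset.mem_univ x, hS (Finset.mem_Ici.1 hx) hSj⟩
    have := Finset.card_le_card this
    rw [Fin.card_Ici] at this
    omega

theorem List.countP_ofFn_eq_card {α : Type*} {m : ℕ} (g : Fin m → α) (p : α → Bool) :
    (List.ofFn g).countP p = (Finset.univ.filter fun j => p (g j)).card := by
  rw [Fin.univ_def, Finset.card_def, Finset.filter_val, Multiset.filter_coe, Multiset.coe_card,
    List.ofFn_eq_map, List.countP_map, List.countP_eq_length_filter]
  simp [Function.comp_def]

namespace CatalanTableau

variable {n : ℕ} (T : CatalanTableau n)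

theorem exists_row_above (j : Fin T.m) :
    ∃ i, ∀ hi : i < T.k, (j : ℕ) < T.m - T.lam ⟨i, hi⟩ :=
  ⟨T.k, fun hi => absurd hi (lt_irrefl _)⟩

open Classical in
/-- The number of cells of a column. -/
noncomputable def height (j : Fin T.m) : ℕ := Nat.find (T.exists_row_above j)

/-- The row containing the 1 of a column. -/
noncomputable def oneRow (j : Fin T.m) : Fin T.k := (T.col_one j).choose

theorem lt_height_iff {i : Fin T.k} {j : Fin T.m} :
    (i : ℕ) < T.height j ↔ T.m - T.lam i ≤ (j : ℕ) := by
  classical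
  rw [height, Nat.lt_find_iff]
  constructor
  · intro h
    have := h i le_rfl
    push Not at this
    exact this.2
  · intro h l hl hlt
    have := T.lam_anti ⟨l, hl.trans_lt i.isLt⟩ i hl
    have := hlt (hl.trans_lt i.isLt)
    omega

theorem height_le (j : Fin T.m) : T.height j ≤ T.k :=
  Nat.find_min' _ fun hi => absurd hi (lt_irrefl _)

theorem height_mono {j j' : Fin T.m} (h : j ≤ j') : T.height j ≤ T.height j' := by
  by_contra! hlt
  have h₁ := T.height_le j
  have h₂ := (T.lt_height_iff (i := ⟨T.height j', by omega⟩)).1 hlt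
  exact lt_irrefl _ (T.lt_height_iff.2 (h₂.trans h))

theorem f_eq_true_iff {i : Fin T.k} {j : Fin T.m} : T.f i j = true ↔ T.oneRow j = i :=
  ⟨fun h => ((T.col_one j).choose_spec.2 i h).symm, fun h => h ▸ (T.col_one j).choose_spec.1⟩

theorem f_eq_false_iff {i : Fin T.k} {j : Fin T.m} : T.f i j = false ↔ T.oneRow j ≠ i := by
  rw [← Bool.not_eq_true, f_eq_true_iff]

theorem oneRow_lt_height (j : Fin T.m) : (T.oneRow j : ℕ) < T.height j := by
  rw [lt_height_iff]
  by_contra! h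
  have := T.f_outside _ _ h
  exact T.f_eq_false_iff.1 this rfl

theorem restricted_iff {i : Fin T.k} {j : Fin T.m} :
    T.Restricted i j ↔ (T.oneRow j : ℕ) < i ∧ (i : ℕ) < T.height j := by
  rw [Restricted, ← lt_height_iff, f_eq_false_iff]
  simp only [f_eq_true_iff]
  constructor
  · rintro ⟨h, -, _, hi, rfl⟩
    exact ⟨hi, h⟩
  · rintro ⟨h₁, h₂⟩
    exact ⟨h₂, fun h => by simp [h] at h₁, _, h₁, rfl⟩

/-- The columns from right to left, each recorded as the row of its 1 and its height. -/
noncomputable def code : List (ℕ × ℕ) :=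
  (List.ofFn fun j => ((T.oneRow j : ℕ), T.height j)).reverse

theorem length_code : T.code.length = T.m := by simp [code]

theorem mem_code {p : ℕ × ℕ} : p ∈ T.code ↔ ∃ j, ((T.oneRow j : ℕ), T.height j) = p := by
  simp [code, List.mem_ofFn']

theorem countP_code (p : ℕ × ℕ → Bool) :
    T.code.countP p = (Finset.univ.filter fun j => p (T.oneRow j, T.height j)).card := by
  rw [code, List.countP_reverse, List.countP_ofFn_eq_card]

theorem validCode_code : ValidCode T.k T.code where
  pos := T.hk
  bound p hp := by
    obtain ⟨j, rfl⟩ := T.mem_code.1 hp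
    exact ⟨T.oneRow_lt_height j, T.height_le j⟩
  pairwise := by
    rw [code, List.pairwise_reverse, List.pairwise_ofFn]
    refine fun j j' hj => ⟨T.height_mono hj.le, fun h => ?_⟩
    exact T.no_bad (T.oneRow j') j (T.lt_height_iff.1 h.2)
      (T.f_eq_false_iff.2 fun he => by simp [he] at h)
      ⟨⟨T.oneRow j, h.1, T.f_eq_true_iff.2 rfl⟩, ⟨j', hj, T.f_eq_true_iff.2 rfl⟩⟩

theorem card_freeRows_code : (freeRows T.k T.code).card = T.unrestrictedRows := by
  classical
  rw [unrestrictedRows, Nat.card_eq_fintype_card, Fintype.card_subtype,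
    ← Finset.card_map Fin.valEmbedding]
  congr 1
  ext i
  simp only [mem_freeRows, mem_code, forall_exists_index, forall_apply_eq_imp_iff,
    Finset.mem_map, Finset.mem_filter, Finset.mem_univ, true_and, restricted_iff,
    Fin.valEmbedding_apply]
  constructor
  · rintro ⟨hi, h⟩
    exact ⟨⟨i, hi⟩, h, rfl⟩
  · rintro ⟨i, h, rfl⟩
    exact ⟨i.isLt, h⟩

theorem countP_fst_code : T.code.countP (fun p => p.1 = 0) = T.onesFirstRow := by
  classical
  rw [onesFirstRow, Nat.card_eq_fintype_card, Fintype.card_subtype, countP_code]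
  simp [f_eq_true_iff, Fin.ext_iff]

theorem countP_lt_code (i : Fin T.k) : T.code.countP (fun p => (i : ℕ) < p.2) = T.lam i := by
  rw [countP_code]
  simp only [decide_eq_true_eq, lt_height_iff]
  have h₁ := T.lam_le i
  have h₂ := Fin.sub_card_filter_le_iff (m := T.m) (fun j => T.m - T.lam i ≤ (j : ℕ))
    fun a b hab h => le_trans h hab
  have h₃ := (Finset.univ.filter fun j : Fin T.m => T.m - T.lam i ≤ (j : ℕ)).card_le_univ
  rw [Fintype.card_fin] at h₃
  set N := (Finset.univ.filter fun j : Fin T.m => T.m - T.lam i ≤ (j : ℕ)).card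
  by_contra hne
  rcases lt_or_gt_of_ne hne with hlt | hlt
  · have := (h₂ ⟨T.m - T.lam i, by omega⟩).2 le_rfl
    simp only at this
    omega
  · have := (h₂ ⟨T.m - N, by omega⟩).1 le_rfl
    simp only at this
    omega

theorem codeProfile_code : codeProfile T.k T.code = T.profile := by
  rw [codeProfile, profile, ← List.map_coe_finRange_eq_range, List.flatMap_map]
  congr 1
  refine List.flatMap_congr fun i _ => ?_
  congr 2
  have hsplit : T.code.countP (fun p => (i : ℕ) < p.2) =
      T.code.countP (fun p => (i : ℕ) + 1 < p.2) +
        T.code.countP (fun p => p.2 = (i : ℕ) + 1) := by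
    generalize T.code = P
    induction P with
    | nil => rfl
    | cons p P ih =>
      simp only [List.countP_cons, ih, decide_eq_true_eq]
      split_ifs <;> omega
  have hnext : T.code.countP (fun p => (i : ℕ) + 1 < p.2) =
      if h : (i : ℕ) + 1 < T.k then T.lam ⟨(i : ℕ) + 1, h⟩ else 0 := by
    split_ifs with h
    · exact T.countP_lt_code ⟨i + 1, h⟩
    · rw [List.countP_eq_zero]
      intro p hp
      have := (T.validCode_code.bound p hp).2
      simp only [decide_eq_true_eq]
      omega
  rw [← hnext, ← T.countP_lt_code i]
  omega

theorem code_injective {T T' : CatalanTableau n} (hk : T.k = T'.k) (hc : T.code = T'.code) :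
    T = T' := by
  have hlam := T.countP_lt_code
  have hlam' := T'.countP_lt_code
  have hf (i j) := T.f_eq_true_iff (i := i) (j := j)
  have hf' (i j) := T'.f_eq_true_iff (i := i) (j := j)
  have hm : T.m = T'.m := by rw [← length_code, ← length_code, hc]
  rw [← hc] at hlam'
  simp only [code, List.reverse_inj] at hc
  generalize T.oneRow = o at *
  generalize T'.oneRow = o' at *
  generalize T.height = g at *
  generalize T'.height = g' at *
  generalize T.code = P at *
  obtain ⟨k, m, _, _, lam, _, _, _, f, _, _, _⟩ := T
  obtain ⟨k', m', _, _, lam', _, _, _, f', _, _, _⟩ := T'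
  dsimp only at *
  subst hk hm
  have ho := List.ofFn_injective hc
  congr
  · funext i
    rw [← hlam, ← hlam']
  · funext i j
    have : o j = o' j := Fin.ext (congrArg Prod.fst (congrFun ho j))
    rw [Bool.eq_iff_iff, hf, hf', this]

theorem exists_code_eq {k : ℕ} {P : List (ℕ × ℕ)} (h : ValidCode k P)
    (hn : k + P.length = n) : ∃ T : CatalanTableau n, T.k = k ∧ T.code = P := by
  obtain ⟨g, hg⟩ : ∃ g : Fin P.length → ℕ × ℕ, (List.ofFn g).reverse = P :=
    ⟨fun j => P.get j.rev, List.ext_getElem (by simp) fun i _ _ => by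
      simp [Fin.rev]; congr 1; grind⟩
  have hbound : ∀ j, (g j).1 < (g j).2 ∧ (g j).2 ≤ k := fun j =>
    h.bound _ (by rw [← hg, List.mem_reverse, List.mem_ofFn']; exact ⟨j, rfl⟩)
  have hpair := h.pairwise
  rw [← hg, List.pairwise_reverse, List.pairwise_ofFn] at hpair
  have hlam (i : ℕ) (j : Fin P.length) :
      P.length - (Finset.univ.filter fun j => i < (g j).2).card ≤ (j : ℕ) ↔ i < (g j).2 := by
    refine Fin.sub_card_filter_le_iff (fun j => i < (g j).2) (fun a b hab hi => ?_) j
    rcases hab.eq_or_lt with rfl | hab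
    · exact hi
    · exact hi.trans_le (hpair hab).1
  let T : CatalanTableau n :=
    { k := k
      m := P.length
      hk := h.pos
      hkm := hn
      lam := fun i => (Finset.univ.filter fun j => (i : ℕ) < (g j).2).card
      lam_le := fun i => (Finset.card_le_univ _).trans_eq (Fintype.card_fin _)
      lam_first := by
        rw [Finset.filter_true_of_mem fun j _ => (Nat.zero_le _).trans_lt (hbound j).1,
          Finset.card_univ, Fintype.card_fin]
      lam_anti := fun i i' hi => Finset.card_le_card
        (Finset.monotone_filter_right _ fun j _ hj => lt_of_le_of_lt (Fin.le_def.1 hi) hj)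
      f := fun i j => decide ((g j).1 = i)
      f_outside := fun i j hj => by
        have h₁ := (not_congr (hlam i j)).1 (not_le.2 hj)
        have h₂ := (hbound j).1
        rw [decide_eq_false_iff_not]
        omega
      col_one := fun j => ⟨⟨(g j).1, (hbound j).1.trans_le (hbound j).2⟩, by simp,
        fun i hi => Fin.ext (of_decide_eq_true hi).symm⟩
      no_bad := by
        rintro i j hj - ⟨⟨i', hi', h₁⟩, j', hjj', h₂⟩
        rw [hlam] at hj
        have h₁ := of_decide_eq_true h₁
        have h₂ := of_decide_eq_true h₂
        exact (hpair (Fin.lt_def.2 hjj')).2 ⟨by rw [h₁, h₂]; exact hi', by rwa [h₂]⟩ }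
  refine ⟨T, rfl, ?_⟩
  have hone (j : Fin T.m) : (T.oneRow j : ℕ) = (g j).1 :=
    (of_decide_eq_true (T.f_eq_true_iff.2 (rfl : T.oneRow j = T.oneRow j))).symm
  have hlt (j : Fin T.m) (i : Fin T.k) : (i : ℕ) < T.height j ↔ (i : ℕ) < (g j).2 :=
    T.lt_height_iff.trans (hlam i j)
  have hheight (j : Fin T.m) : T.height j = (g j).2 := by
    have h₁ : T.height j ≤ k := T.height_le j
    have h₂ := (hbound j).2
    by_contra hne
    rcases lt_or_gt_of_ne hne with hl | hl
    · exact lt_irrefl _ ((hlt j ⟨_, hl.trans_le h₂⟩).2 hl)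
    · exact lt_irrefl _ ((hlt j ⟨_, hl.trans_le h₁⟩).1 hl)
  have : (fun j => ((T.oneRow j : ℕ), T.height j)) = g :=
    funext fun j => Prod.ext (hone j) (hheight j)
  rw [code, this, hg]

/-- The binary tree associated with a Catalan tableau. -/
noncomputable def toBinTree : BinTree := codeTree T.k T.code

theorem size_toBinTree : T.toBinTree.size = n := by
  rw [toBinTree, size_codeTree T.validCode_code, length_code, T.hkm]

theorem canopy_toBinTree : T.toBinTree.canopy = T.profile := by
  rw [toBinTree, canopy_codeTree T.validCode_code, codeProfile_code]

theorem leftBranchLen_toBinTree : T.toBinTree.leftBranchLen = T.onesFirstRow + 1 := by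
  rw [toBinTree, leftBranchLen_codeTree T.validCode_code, countP_fst_code]

theorem rightBranchLen_toBinTree : T.toBinTree.rightBranchLen = T.unrestrictedRows := by
  rw [toBinTree, rightBranchLen_codeTree T.validCode_code, card_freeRows_code]

theorem toBinTree_injective : Function.Injective (toBinTree (n := n)) := fun T T' h =>
  have := codeTree_injective T.validCode_code T'.validCode_code h
  code_injective this.1 this.2

theorem exists_toBinTree_eq (hn : 1 ≤ n) {B : BinTree} (hB : B.size = n) :
    ∃ T : CatalanTableau n, T.toBinTree = B := by
  have hne : B ≠ .nil := by
    rintro rfl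
    simp only [BinTree.size] at hB
    omega
  obtain ⟨k, P, hv, rfl⟩ := exists_codeTree_eq hne
  obtain ⟨T, rfl, rfl⟩ := exists_code_eq hv (by rw [← size_codeTree hv, hB])
  exact ⟨T, rfl⟩

end CatalanTableau

/-- For every integer `n ≥ 1`, every word `u` of length `n - 1`
over `{a, b}`, and all integers `j ≥ 0` and `r ≥ 1`, the number of Catalan
tableaux of index `n` with profile `u`, exactly `j` ones in the first row, and
exactly `r` unrestricted rows equals the number of binary trees with `n`
vertices with canopy `u` whose left branch has length `j + 1` and whose right
branch has length `r`. -/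
theorem card_catalanTableau_refined_eq_card_binTree_refined
    (n : ℕ) (hn : 1 ≤ n) (u : List Bool) (hu : u.length = n - 1)
    (j r : ℕ) (hr : 1 ≤ r) :
    Nat.card {T : CatalanTableau n //
        T.profile = u ∧ T.onesFirstRow = j ∧ T.unrestrictedRows = r} =
      Nat.card {B : BinTree //
        B.size = n ∧ B.canopy = u ∧ B.leftBranchLen = j + 1 ∧ B.rightBranchLen = r} := by
  refine Nat.card_congr (Equiv.ofBijective (fun T => ⟨T.1.toBinTree, ?_⟩) ⟨?_, ?_⟩)
  · obtain ⟨T, h₁, h₂, h₃⟩ := T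
    exact ⟨T.size_toBinTree, by rw [T.canopy_toBinTree, h₁],
      by rw [T.leftBranchLen_toBinTree, h₂], by rw [T.rightBranchLen_toBinTree, h₃]⟩
  · exact fun T T' h => Subtype.ext (CatalanTableau.toBinTree_injective (congrArg Subtype.val h))
  · rintro ⟨B, hs, h₁, h₂, h₃⟩
    obtain ⟨T, rfl⟩ := CatalanTableau.exists_toBinTree_eq hn hs
    rw [T.canopy_toBinTree] at h₁
    rw [T.leftBranchLen_toBinTree, Nat.add_right_cancel_iff] at h₂
    rw [T.rightBranchLen_toBinTree] at h₃
    exact ⟨⟨T, h₁, h₂, h₃⟩, rfl⟩
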